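/- There do not exist: a bounded lattice K with top ⊤ and bottom ⊥, a map c : K → K satisfying c(c(u)) = u, (u ≤ w → c(w) ≤ c(u)), u ∨ c(u) = ⊤, u ∧ c(u) = ⊥, and the orthomodular law (u ≤ w → u ∨ (c(u) ∧ w) = w) for all u,w ∈ K; a map ι : L → K which is an order embedding (f ≤ g pointwise on S iff ι(f) ≤ ι(g)); and for each P ∈ S a function μ_P : K → ℝ with 0 ≤ μ_P(k) ≤ 1 for all k, μ_P(⊤) = 1, μ_P(u ∨ w) = μ_P(u) + μ_P(w) whenever u ≤ c(w), μ_P(ι(f)) = f(P) for all f ∈ L, and such that P ↦ μ_P(k) is affine for each fixed k (μ_{tP+(1−t)Q}(k) = t·μ_P(k) + (1−t)·μ_Q(k) for all P,Q ∈ S, t ∈ [0,1]). In other words, the logic of the (2,2)-box world cannot be embedded into an orthomodular lattice in a way that (affinely) preserves all (2,2)-box states. -/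

import Mathlib

namespace BoxWorld

/-- A (2,2)-box assignment: `P a b α β` stands for `P(αβ|ab)`, where the measurement
settings are `a, b ∈ Fin 2` (with `x = 0`, `y = 1`) and the outcomes are `α, β ∈ Fin 2`. -/
abbrev Box : Type := Fin 2 → Fin 2 → Fin 2 → Fin 2 → ℝ

/-- (P1) positivity, (P2) normalization, (P3) non-signalling. -/
def IsState (P : Box) : Prop :=
  (∀ a b α β, 0 ≤ P a b α β) ∧
  (∀ a b, ∑ α : Fin 2, ∑ β : Fin 2, P a b α β = 1) ∧
  (∀ a b b' α, ∑ β : Fin 2, P a b α β = ∑ β : Fin 2, P a b' α β) ∧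
  (∀ a a' b β, ∑ α : Fin 2, P a b α β = ∑ α : Fin 2, P a' b α β)

/-- The set `S` of (2,2)-box states, as a subtype. -/
abbrev State : Type := {P : Box // IsState P}

/-- The elementary question `e[ab, αβ]`, as a functional on states. -/
def elem (a b α β : Fin 2) : State → ℝ := fun P => P.1 a b α β

abbrev Idx : Type := Fin 2 × Fin 2 × Fin 2 × Fin 2

def elemI (i : Idx) : State → ℝ := elem i.1 i.2.1 i.2.2.1 i.2.2.2

/-- The logic `L` of the (2,2)-box world: all functionals `f = Σ_{e ∈ A} e`, where `A` is a
set of elementary questions whose pointwise sum is `≤ 1` at every state, together with the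
complements `1 - f` of all such functionals. -/
def InLogic (f : State → ℝ) : Prop :=
  (∃ A : Finset Idx, (∀ P : State, ∑ i ∈ A, elemI i P ≤ 1) ∧
      f = fun P => ∑ i ∈ A, elemI i P) ∨
  (∃ A : Finset Idx, (∀ P : State, ∑ i ∈ A, elemI i P ≤ 1) ∧
      f = fun P => 1 - ∑ i ∈ A, elemI i P)

/-- The convex combination `t·P + (1-t)·Q` of two boxes. -/
def mix (t : ℝ) (P Q : Box) : Box :=
  fun a b α β => t * P a b α β + (1 - t) * Q a b α β

/-- The data of an embedding of the logic `L` of the (2,2)-box world into an orthomodular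
lattice `K` together with, for each (2,2)-box state, an extension to a finitely additive
probability measure on `K`, depending affinely on the state. -/
structure OMLEmbedding where
  /-- the ambient lattice -/
  K : Type*
  [latt : Lattice K]
  [bdd : BoundedOrder K]
  /-- the orthocomplementation -/
  compl : K → K
  compl_compl : ∀ u, compl (compl u) = u
  compl_antitone : ∀ u w, u ≤ w → compl w ≤ compl u
  sup_compl : ∀ u, u ⊔ compl u = ⊤
  inf_compl : ∀ u, u ⊓ compl u = ⊥
  orthomodular : ∀ u w, u ≤ w → u ⊔ (compl u ⊓ w) = w
  /-- the embedding of the logic of the (2,2)-box world -/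
  ι : {f : State → ℝ // InLogic f} → K
  ι_order_embedding : ∀ f g : {f : State → ℝ // InLogic f},
    (∀ P : State, f.1 P ≤ g.1 P) ↔ ι f ≤ ι g
  /-- the extension of each (2,2)-box state to a state on `K` -/
  μ : State → K → ℝ
  μ_nonneg : ∀ P k, 0 ≤ μ P k
  μ_le_one : ∀ P k, μ P k ≤ 1
  μ_top : ∀ P, μ P ⊤ = 1
  μ_add : ∀ (P : State) (u w : K), u ≤ compl w → μ P (u ⊔ w) = μ P u + μ P w
  μ_extends : ∀ (P : State) (f : {f : State → ℝ // InLogic f}), μ P (ι f) = f.1 P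
  μ_affine : ∀ (P Q R : State) (t : ℝ), 0 ≤ t → t ≤ 1 → R.1 = mix t P.1 Q.1 →
    ∀ k, μ R k = t * μ P k + (1 - t) * μ Q k

lemma IsState.mix {P Q : Box} (hP : IsState P) (hQ : IsState Q) {t : ℝ} (h0 : 0 ≤ t)
    (h1 : t ≤ 1) : IsState (mix t P Q) := by
  obtain ⟨p1, p2, p3, p4⟩ := hP
  obtain ⟨q1, q2, q3, q4⟩ := hQ
  refine ⟨fun a b α β => ?_, fun a b => ?_, fun a b b' α => ?_, fun a a' b β => ?_⟩
  · exact add_nonneg (mul_nonneg h0 (p1 ..)) (mul_nonneg (sub_nonneg.2 h1) (q1 ..))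
  · simp only [BoxWorld.mix, Finset.sum_add_distrib, ← Finset.mul_sum, p2, q2]
    ring
  · simp only [BoxWorld.mix, Finset.sum_add_distrib, ← Finset.mul_sum, p3 a b b', q3 a b b']
  · simp only [BoxWorld.mix, Finset.sum_add_distrib, ← Finset.mul_sum, p4 a a' b, q4 a a' b]

/-- The deterministic state in which the settings `a` and `b` have outcomes `f a` and `g b`. -/
def detState (f g : Fin 2 → Fin 2) : State :=
  ⟨fun a b α β => (if α = f a then 1 else 0) * (if β = g b then 1 else 0), by
    refine ⟨fun a b α β => ?_, fun a b => ?_, fun a b b' α => ?_, fun a a' b β => ?_⟩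
    · positivity
    all_goals simp⟩

lemma detState_apply (f g : Fin 2 → Fin 2) (a b α β : Fin 2) :
    (detState f g).1 a b α β = (if α = f a then 1 else 0) * (if β = g b then 1 else 0) :=
  rfl

/-- The Popescu–Rohrlich box whose outcomes agree unless both settings are `x`. -/
noncomputable def prState : State :=
  ⟨fun a b α β => if α = β ↔ ¬ (a = 0 ∧ b = 0) then 1 / 2 else 0, by
    refine ⟨fun a b α β => ?_, ?_, ?_, ?_⟩
    · positivity
    all_goals simp [Fin.forall_fin_two, Fin.sum_univ_two]
    all_goals norm_num⟩

lemma prState_apply (a b α β : Fin 2) :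
    prState.1 a b α β = if α = β ↔ ¬ (a = 0 ∧ b = 0) then 1 / 2 else 0 :=
  rfl

/-- The convex combination of two states, as a state. -/
def mixState (t : ℝ) (h0 : 0 ≤ t) (h1 : t ≤ 1) (P Q : State) : State :=
  ⟨mix t P.1 Q.1, P.2.mix Q.2 h0 h1⟩

lemma inLogic_of_sum_le_one (A : Finset Idx) (h : ∀ P : State, ∑ i ∈ A, elemI i P ≤ 1) :
    InLogic fun P => ∑ i ∈ A, elemI i P :=
  Or.inl ⟨A, h, rfl⟩

/-- The affine relation between one Popescu–Rohrlich box and four deterministic states. -/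
lemma mix_det_pr_eq :
    mix (1 / 3) (detState ![0, 0] ![0, 1]).1 prState.1 =
      mix (1 / 3) (detState ![0, 0] ![0, 0]).1
        (mix (1 / 2) (detState ![0, 1] ![1, 1]).1 (detState ![1, 0] ![0, 1]).1) := by
  funext a b α β
  fin_cases a <;> fin_cases b <;> fin_cases α <;> fin_cases β <;>
    norm_num [mix, detState_apply, prState_apply]

namespace OMLEmbedding

variable (M : OMLEmbedding)

attribute [local instance] OMLEmbedding.latt OMLEmbedding.bdd

lemma μ_mono (P : State) {u w : M.K} (h : u ≤ w) : M.μ P u ≤ M.μ P w := by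
  have h' : u ≤ M.compl (M.compl u ⊓ w) := by
    simpa only [M.compl_compl] using M.compl_antitone _ _ (inf_le_left : M.compl u ⊓ w ≤ _)
  have := M.μ_add P u _ h'
  rw [M.orthomodular u w h] at this
  linarith [M.μ_nonneg P (M.compl u ⊓ w)]

lemma μ_mixState (t : ℝ) (h0 : 0 ≤ t) (h1 : t ≤ 1) (P Q : State) (k : M.K) :
    M.μ (mixState t h0 h1 P Q) k = t * M.μ P k + (1 - t) * M.μ Q k :=
  M.μ_affine P Q _ t h0 h1 rfl k

/-- Whenever `e₁, e₂ ≤ g₁, g₂` in the logic, some element of the lattice, namely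
`ι e₁ ⊔ ι e₂`, interpolates between them. -/
lemma exists_interpolant (e₁ e₂ g₁ g₂ : {f : State → ℝ // InLogic f})
    (h₁₁ : ∀ P, e₁.1 P ≤ g₁.1 P) (h₁₂ : ∀ P, e₁.1 P ≤ g₂.1 P)
    (h₂₁ : ∀ P, e₂.1 P ≤ g₁.1 P) (h₂₂ : ∀ P, e₂.1 P ≤ g₂.1 P) :
    ∃ k : M.K, ∀ P, e₁.1 P ≤ M.μ P k ∧ e₂.1 P ≤ M.μ P k ∧
      M.μ P k ≤ g₁.1 P ∧ M.μ P k ≤ g₂.1 P := by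
  refine ⟨M.ι e₁ ⊔ M.ι e₂, fun P => ?_⟩
  simp only [← M.μ_extends P]
  exact ⟨M.μ_mono P le_sup_left, M.μ_mono P le_sup_right,
    M.μ_mono P (sup_le ((M.ι_order_embedding _ _).1 h₁₁) ((M.ι_order_embedding _ _).1 h₂₁)),
    M.μ_mono P (sup_le ((M.ι_order_embedding _ _).1 h₁₂) ((M.ι_order_embedding _ _).1 h₂₂))⟩

end OMLEmbedding

/-- The logic of the (2,2)-box world cannot be embedded into an orthomodular
lattice in a way that (affinely) preserves all (2,2)-box states. -/
theorem no_embedding_into_orthomodular_lattice : ¬ Nonempty OMLEmbedding.{0} := by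
  rintro ⟨M⟩
  let E₁ : Finset Idx := {(0, 0, 0, 0)}
  let E₂ : Finset Idx := {(1, 1, 0, 0)}
  let G₁ : Finset Idx := {(0, 0, 0, 0), (0, 0, 0, 1), (0, 1, 1, 0)}
  let G₂ : Finset Idx := {(0, 0, 0, 0), (0, 0, 1, 0), (1, 0, 0, 1)}
  have sum_E₁ (P : State) : ∑ i ∈ E₁, elemI i P = P.1 0 0 0 0 := by simp [E₁, elemI, elem]
  have sum_E₂ (P : State) : ∑ i ∈ E₂, elemI i P = P.1 1 1 0 0 := by simp [E₂, elemI, elem]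
  have sum_G₁ (P : State) :
      ∑ i ∈ G₁, elemI i P = P.1 0 0 0 0 + (P.1 0 0 0 1 + P.1 0 1 1 0) := by
    simp [G₁, elemI, elem]
  have sum_G₂ (P : State) :
      ∑ i ∈ G₂, elemI i P = P.1 0 0 0 0 + (P.1 0 0 1 0 + P.1 1 0 0 1) := by
    simp [G₂, elemI, elem]
  have bounds (P : State) : P.1 0 0 0 0 ≤ 1 ∧ P.1 1 1 0 0 ≤ 1 ∧
      P.1 0 0 0 0 + (P.1 0 0 0 1 + P.1 0 1 1 0) ≤ 1 ∧
      P.1 0 0 0 0 + (P.1 0 0 1 0 + P.1 1 0 0 1) ≤ 1 ∧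
      P.1 0 0 0 0 ≤ P.1 0 0 0 0 + (P.1 0 0 0 1 + P.1 0 1 1 0) ∧
      P.1 0 0 0 0 ≤ P.1 0 0 0 0 + (P.1 0 0 1 0 + P.1 1 0 0 1) ∧
      P.1 1 1 0 0 ≤ P.1 0 0 0 0 + (P.1 0 0 0 1 + P.1 0 1 1 0) ∧
      P.1 1 1 0 0 ≤ P.1 0 0 0 0 + (P.1 0 0 1 0 + P.1 1 0 0 1) := by
    obtain ⟨P, pos, norm, nsA, nsB⟩ := P
    simp only [Fin.forall_fin_two, Fin.sum_univ_two] at pos norm nsA nsB ⊢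
    refine ⟨?_, ?_, ?_, ?_, ?_, ?_, ?_, ?_⟩ <;> linarith
  obtain ⟨k, hk⟩ := M.exists_interpolant
    ⟨_, inLogic_of_sum_le_one E₁ fun P => sum_E₁ P ▸ (bounds P).1⟩
    ⟨_, inLogic_of_sum_le_one E₂ fun P => sum_E₂ P ▸ (bounds P).2.1⟩
    ⟨_, inLogic_of_sum_le_one G₁ fun P => sum_G₁ P ▸ (bounds P).2.2.1⟩
    ⟨_, inLogic_of_sum_le_one G₂ fun P => sum_G₂ P ▸ (bounds P).2.2.2.1⟩
    (fun P => by simpa only [sum_E₁, sum_G₁] using (bounds P).2.2.2.2.1)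
    (fun P => by simpa only [sum_E₁, sum_G₂] using (bounds P).2.2.2.2.2.1)
    (fun P => by simpa only [sum_E₂, sum_G₁] using (bounds P).2.2.2.2.2.2.1)
    (fun P => by simpa only [sum_E₂, sum_G₂] using (bounds P).2.2.2.2.2.2.2)
  simp only [sum_E₁, sum_E₂, sum_G₁, sum_G₂] at hk
  have lower_det := (hk (detState ![0, 0] ![0, 1])).1
  have lower_pr := (hk prState).2.1
  have upper_det₀ := (hk (detState ![0, 0] ![0, 0])).2.2.1
  have upper_det₁ := (hk (detState ![0, 1] ![1, 1])).2.2.2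
  have upper_det₂ := (hk (detState ![1, 0] ![0, 1])).2.2.1
  have key : mixState (1 / 3) (by norm_num) (by norm_num) (detState ![0, 0] ![0, 1]) prState =
      mixState (1 / 3) (by norm_num) (by norm_num) (detState ![0, 0] ![0, 0])
        (mixState (1 / 2) (by norm_num) (by norm_num)
          (detState ![0, 1] ![1, 1]) (detState ![1, 0] ![0, 1])) :=
    Subtype.ext mix_det_pr_eq
  have affine := congrArg (M.μ · k) key
  simp only [M.μ_mixState] at affine
  norm_num [detState_apply] at lower_det upper_det₀ upper_det₁ upper_det₂
  norm_num [prState_apply] at lower_pr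
  linarith

end BoxWorld
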